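/- Let k ≥ 1 and let a_0,…,a_{k−1}, b_0,…,b_k, c_0,…,c_{k−1} be real numbers whose sums satisfy ∑_{j=0}^{k−1} a_j = 1, ∑_{j=0}^{k} b_j = 1 and ∑_{j=0}^{k−1} c_j = 1 (consistency of the k-step IEMS method), and suppose the trigonometric polynomial a(θ) = ∑_{j=0}^{k−1} a_j e^{ijθ} is nonzero for every θ ∈ [0,2π). Define σ_F := max_{θ∈[0,2π)} |1/a(θ)|, σ_E := max_{θ∈[0,2π)} |c(θ)/a(θ)| and λ_I := min_{θ∈[0,2π)} Re(b(θ)/a(θ)), where b(θ) = ∑_{j=0}^{k} b_j e^{ijθ} and c(θ) = ∑_{j=0}^{k−1} c_j e^{ijθ}. Then σ_F ≥ 1, σ_E ≥ 1 and λ_I ≤ 1, and consequently the implicit–explicit controllability intensity λ_I/σ_E is at most 1. Moreover, for the implicit–explicit Euler scheme (k = 1 with a_0 = b_0 = c_0 = 1 and b_1 = 0) one has σ_F = σ_E = λ_I = 1, so its controllability intensity equals 1. -/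

import Mathlib

open Real Set

/-- The semi-generating function of a finite real sequence. -/
noncomputable def semiGen (n : ℕ) (p : ℕ → ℝ) (θ : ℝ) : ℂ :=
  ∑ j ∈ Finset.range n, (p j : ℂ) * Complex.exp (Complex.I * j * θ)

lemma continuous_semiGen (n : ℕ) (p : ℕ → ℝ) : Continuous (semiGen n p) := by
  unfold semiGen
  fun_prop

lemma semiGen_zero {n : ℕ} {p : ℕ → ℝ} (hp : ∑ j ∈ Finset.range n, p j = 1) :
    semiGen n p 0 = 1 := by
  simp only [semiGen, Complex.ofReal_zero, mul_zero, Complex.exp_zero, mul_one]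
  exact_mod_cast hp

lemma semiGen_two_pi (n : ℕ) (p : ℕ → ℝ) : semiGen n p (2 * π) = semiGen n p 0 := by
  refine Finset.sum_congr rfl fun j _ => ?_
  congr 1
  rw [Complex.ofReal_zero, mul_zero, Complex.exp_zero, Complex.exp_eq_one_iff]
  exact ⟨j, by push_cast; ring⟩

lemma semiGen_ne_zero_of_mem_Icc {n : ℕ} {p : ℕ → ℝ}
    (hp : ∀ θ ∈ Ico (0 : ℝ) (2 * π), semiGen n p θ ≠ 0) :
    ∀ θ ∈ Icc (0 : ℝ) (2 * π), semiGen n p θ ≠ 0 := by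
  intro θ hθ
  rcases hθ.2.lt_or_eq with h | rfl
  · exact hp θ ⟨hθ.1, h⟩
  · rw [semiGen_two_pi]
    exact hp 0 ⟨le_rfl, two_pi_pos⟩

lemma le_sSup_image_Ico {f : ℝ → ℝ} {x y : ℝ} (hxy : x < y) (hf : ContinuousOn f (Icc x y)) :
    f x ≤ sSup (f '' Ico x y) :=
  le_csSup ((isCompact_Icc.bddAbove_image hf).mono (image_mono Ico_subset_Icc_self))
    (mem_image_of_mem f (left_mem_Ico.2 hxy))

lemma sInf_image_Ico_le {f : ℝ → ℝ} {x y : ℝ} (hxy : x < y) (hf : ContinuousOn f (Icc x y)) :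
    sInf (f '' Ico x y) ≤ f x :=
  csInf_le ((isCompact_Icc.bddBelow_image hf).mono (image_mono Ico_subset_Icc_self))
    (mem_image_of_mem f (left_mem_Ico.2 hxy))

/-- for any consistent k-step IEMS method the perturbation
amplification factor and nonlinear amplification factor are at least 1 and
the dissipation preserving factor is at most 1, hence the implicit–explicit
controllability intensity is at most 1; the implicit–explicit Euler scheme
attains the optimal value 1. -/
theorem stmt6 (k : ℕ) (hk : 1 ≤ k) (a b c : ℕ → ℝ)
    (hsa : ∑ j ∈ Finset.range k, a j = 1)
    (hsb : ∑ j ∈ Finset.range (k + 1), b j = 1)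
    (hsc : ∑ j ∈ Finset.range k, c j = 1)
    (aF bF cF : ℝ → ℂ)
    (haF : ∀ θ : ℝ, aF θ = ∑ j ∈ Finset.range k, (a j : ℂ) * Complex.exp (Complex.I * j * θ))
    (hbF : ∀ θ : ℝ, bF θ = ∑ j ∈ Finset.range (k + 1), (b j : ℂ) * Complex.exp (Complex.I * j * θ))
    (hcF : ∀ θ : ℝ, cF θ = ∑ j ∈ Finset.range k, (c j : ℂ) * Complex.exp (Complex.I * j * θ))
    (hane : ∀ θ ∈ Set.Ico (0:ℝ) (2*π), aF θ ≠ 0)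
    (sigF sigE lamI : ℝ)
    (hsigF : sigF = sSup ((fun θ : ℝ => ‖1 / aF θ‖) '' Set.Ico (0:ℝ) (2*π)))
    (hsigE : sigE = sSup ((fun θ : ℝ => ‖cF θ / aF θ‖) '' Set.Ico (0:ℝ) (2*π)))
    (hlamI : lamI = sInf ((fun θ : ℝ => (bF θ / aF θ).re) '' Set.Ico (0:ℝ) (2*π))) :
    1 ≤ sigF ∧ 1 ≤ sigE ∧ lamI ≤ 1 ∧ lamI / sigE ≤ 1 ∧
      (k = 1 → a 0 = 1 → b 0 = 1 → b 1 = 0 → c 0 = 1 →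
        sigF = 1 ∧ sigE = 1 ∧ lamI = 1 ∧ lamI / sigE = 1) := by
  obtain rfl : aF = semiGen k a := funext haF
  obtain rfl : bF = semiGen (k + 1) b := funext hbF
  obtain rfl : cF = semiGen k c := funext hcF
  have hne := semiGen_ne_zero_of_mem_Icc hane
  have ha := (continuous_semiGen k a).continuousOn (s := Icc 0 (2 * π))
  have hb := (continuous_semiGen (k + 1) b).continuousOn (s := Icc 0 (2 * π))
  have hc := (continuous_semiGen k c).continuousOn (s := Icc 0 (2 * π))
  have hF : 1 ≤ sigF := by
    have h := le_sSup_image_Ico two_pi_pos (continuousOn_const (c := (1 : ℂ)) |>.div ha hne).norm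
    simpa only [hsigF, Pi.div_apply, semiGen_zero hsa, div_one, norm_one] using h
  have hE : 1 ≤ sigE := by
    have h := le_sSup_image_Ico two_pi_pos (hc.div ha hne).norm
    simpa only [hsigE, Pi.div_apply, semiGen_zero hsa, semiGen_zero hsc, div_one, norm_one] using h
  have hI : lamI ≤ 1 := by
    have h := sInf_image_Ico_le two_pi_pos (Complex.continuous_re.comp_continuousOn (hb.div ha hne))
    simpa only [hlamI, Function.comp_def, Pi.div_apply, semiGen_zero hsa, semiGen_zero hsb,
      div_one, Complex.one_re] using h
  refine ⟨hF, hE, hI, (div_le_one (by linarith)).2 (hI.trans hE), ?_⟩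
  rintro rfl ha0 hb0 hb1 hc0
  have hA : semiGen 1 a = 1 := by ext θ; simp [semiGen, ha0]
  have hB : semiGen (1 + 1) b = 1 := by ext θ; simp [semiGen, Finset.sum_range_succ, hb0, hb1]
  have hC : semiGen 1 c = 1 := by ext θ; simp [semiGen, hc0]
  have hIco : (Ico (0 : ℝ) (2 * π)).Nonempty := nonempty_Ico.2 two_pi_pos
  have hF1 : sigF = 1 := by simp [hsigF, hA, hIco.image_const]
  have hE1 : sigE = 1 := by simp [hsigE, hA, hC, hIco.image_const]
  have hI1 : lamI = 1 := by simp [hlamI, hA, hB, hIco.image_const]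
  exact ⟨hF1, hE1, hI1, by rw [hE1, hI1, div_one]⟩
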